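/- Let w = Π_i u_i v_i with u_i ∈ M_{e_i} and v_i ∈ M_{d_i}, and put u = Π_i u_i and v = Π_i v_i. If f_k(v(n1,...,n6)) ∈ f_k(S(v)) for all n1,...,n6 with n1+...+n6 = deg v, then R_k(w(n1,...,n6)) ∈ R_k(S(w)) for all n1,...,n6 with n1+...+n6 = m_k. (Here f_k(S(v)) and R_k(S(w)) denote images, which are K-subspaces.) -/

import Mathlib

open scoped Classical BigOperators

noncomputable section

/-- The free associative unital `K`-algebra on six generators `x1 x2 x3 y1 y2 y3`,
realized as the monoid algebra of the free monoid on six letters. -/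
abbrev FreeA (K : Type) [Field K] : Type := MonoidAlgebra K (FreeMonoid (Fin 6))

/-- The map sending the generators `x1 x2 x3` to `x` and `y1 y2 y3` to `y`. -/
def bf : Fin 6 → Fin 2 := fun i => if (i : ℕ) < 3 then 0 else 1

/-- The monoid homomorphism `β` from monomials in six letters to monomials in two letters. -/
def bm : FreeMonoid (Fin 6) →* FreeMonoid (Fin 2) := FreeMonoid.map bf

/-- Degree (length) of a monomial. -/
def len {α : Type} (w : FreeMonoid α) : ℕ := (FreeMonoid.toList w).length

/-- The ordering `≺` on monomials in `x, y`: same degree and lexicographically smaller. -/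
def prec (z z' : FreeMonoid (Fin 2)) : Prop :=
  len z = len z' ∧ List.Lex (· < ·) (FreeMonoid.toList z) (FreeMonoid.toList z')

/-- The finite set of monomials of degree `n` in six letters. -/
def wordsOf (n : ℕ) : Finset (FreeMonoid (Fin 6)) :=
  (Finset.univ : Finset (Fin n → Fin 6)).image fun f => FreeMonoid.ofList (List.ofFn f)

/-- `wComp K z n` is `z(n₁,…,n₆)`: the sum of all monomials `v` (in six letters) with
`β v = z` and with exactly `nᵢ` occurrences of the `i`-th generator; it is `0` if no such
monomial exists (in particular if some `nᵢ` is negative). -/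
def wComp (K : Type) [Field K] (z : FreeMonoid (Fin 2)) (n : Fin 6 → ℤ) : FreeA K :=
  ∑ v ∈ (wordsOf (len z)).filter
      (fun v => bm v = z ∧ ∀ e : Fin 6, ((FreeMonoid.toList v).count e : ℤ) = n e),
    MonoidAlgebra.single v 1

/-- `H_i`: the `K`-span of the monomials of degree `i`. -/
def Hgr (K : Type) [Field K] (i : ℕ) : Submodule K (FreeA K) :=
  Submodule.span K {a | ∃ w : FreeMonoid (Fin 6), len w = i ∧ a = MonoidAlgebra.single w (1 : K)}

/-- `S(z)` for `z` a monomial in `x, y`: the span of the monomials `w` in six letters of the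
same degree with `β w ≺ z`.  (For a monomial `z` in six letters, `S(z) = SP K (bm z)`.) -/
def SP (K : Type) [Field K] (z : FreeMonoid (Fin 2)) : Submodule K (FreeA K) :=
  Submodule.span K
    {a | ∃ w : FreeMonoid (Fin 6), len w = len z ∧ prec (bm w) z ∧
      a = MonoidAlgebra.single w (1 : K)}

/-- `Q(z)`: the span of the monomials `w` of the same degree with `β w = z`. -/
def QP (K : Type) [Field K] (z : FreeMonoid (Fin 2)) : Submodule K (FreeA K) :=
  Submodule.span K
    {a | ∃ w : FreeMonoid (Fin 6), len w = len z ∧ bm w = z ∧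
      a = MonoidAlgebra.single w (1 : K)}

end

noncomputable section

/-- The monomial of degree `n` given by a function on letter positions. -/
def wordOfFn {n : ℕ} (f : Fin n → Fin 6) : FreeMonoid (Fin 6) :=
  FreeMonoid.ofList (List.ofFn f)

end

noncomputable section

/-- Degree as a function on products of monomials. -/
theorem len_mul {α : Type} (a b : FreeMonoid α) : len (a * b) = len a + len b := by
  simp [len, FreeMonoid.toList_mul]

theorem len_one {α : Type} : len (1 : FreeMonoid α) = 0 := rfl

theorem len_bm (a : FreeMonoid (Fin 6)) : len (bm a) = len a := by
  simp [len, bm, FreeMonoid.toList_map]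

/-- An additive function of monomials is additive on ordered products. -/
theorem additive_ofFn_prod {M : Type*} [Monoid M] (f : M → ℕ) (h1 : f 1 = 0)
    (hmul : ∀ a b, f (a * b) = f a + f b) :
    ∀ {s : ℕ} (W : Fin s → M), f (List.ofFn W).prod = ∑ i, f (W i)
  | 0, W => by simpa using h1
  | s + 1, W => by
    rw [List.ofFn_succ, List.prod_cons, hmul, Fin.sum_univ_succ,
      additive_ofFn_prod f h1 hmul]

theorem len_ofFn_prod {α : Type} {s : ℕ} (W : Fin s → FreeMonoid α) :
    len (List.ofFn W).prod = ∑ i, len (W i) :=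
  additive_ofFn_prod len len_one len_mul W

theorem count_ofFn_prod {s : ℕ} (c : Fin 6) (W : Fin s → FreeMonoid (Fin 6)) :
    (FreeMonoid.toList (List.ofFn W).prod).count c =
      ∑ i, (FreeMonoid.toList (W i)).count c :=
  additive_ofFn_prod (fun a => (FreeMonoid.toList a).count c) (by simp)
    (fun a b => by simp [FreeMonoid.toList_mul]) W

theorem mul_inj_of_len {α : Type} {a b c d : FreeMonoid α} (hl : len a = len c)
    (h : a * b = c * d) : a = c ∧ b = d := by
  have h' := congrArg FreeMonoid.toList h
  rw [FreeMonoid.toList_mul, FreeMonoid.toList_mul] at h'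
  have := List.append_inj h' hl
  exact ⟨FreeMonoid.toList.injective this.1, FreeMonoid.toList.injective this.2⟩

/-- A product of monomials determines its factors once their degrees are fixed. -/
theorem ofFn_prod_inj {α : Type} : ∀ {s : ℕ} {V W : Fin s → FreeMonoid α},
    (∀ i, len (V i) = len (W i)) → (List.ofFn V).prod = (List.ofFn W).prod → V = W
  | 0, V, W, _, _ => Subsingleton.elim _ _
  | s + 1, V, W, hl, h => by
    rw [List.ofFn_succ, List.ofFn_succ, List.prod_cons, List.prod_cons] at h
    obtain ⟨h0, h1⟩ := mul_inj_of_len (hl 0) h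
    have h2 := ofFn_prod_inj (fun i => hl i.succ) h1
    funext i
    refine Fin.cases h0 (fun j => congrFun h2 j) i

theorem exists_mul_of_len {α : Type} {p q : ℕ} {x : FreeMonoid α} (h : len x = p + q) :
    ∃ a b, len a = p ∧ len b = q ∧ a * b = x := by
  refine ⟨FreeMonoid.ofList ((FreeMonoid.toList x).take p),
    FreeMonoid.ofList ((FreeMonoid.toList x).drop p), ?_, ?_, ?_⟩
  · simp only [len, FreeMonoid.toList_ofList, List.length_take] at *
    omega
  · simp only [len, FreeMonoid.toList_ofList, List.length_drop] at *
    omega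
  · rw [← FreeMonoid.ofList_append, List.take_append_drop, FreeMonoid.ofList_toList]

/-- Every monomial of degree `∑ dᵢ` is a product of monomials of degrees `dᵢ`. -/
theorem exists_ofFn_prod {α : Type} : ∀ {s : ℕ} (d : Fin s → ℕ) (x : FreeMonoid α),
    len x = ∑ i, d i → ∃ V : Fin s → FreeMonoid α,
      (∀ i, len (V i) = d i) ∧ (List.ofFn V).prod = x
  | 0, d, x, h => ⟨fun _ => 1, fun i => i.elim0, by
      have hx : FreeMonoid.toList x = [] := List.length_eq_zero_iff.mp (by simpa [len] using h)
      exact (FreeMonoid.toList.injective (hx.trans FreeMonoid.toList_one.symm)).symm⟩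
  | s + 1, d, x, h => by
    rw [Fin.sum_univ_succ] at h
    obtain ⟨a, b, ha, hb, rfl⟩ := exists_mul_of_len h
    obtain ⟨V, hV, rfl⟩ := exists_ofFn_prod (fun i => d i.succ) b hb
    refine ⟨Fin.cons a V, fun i => Fin.cases (by simpa using ha) (fun j => by simpa using hV j) i, ?_⟩
    rw [List.ofFn_succ, List.prod_cons]
    simp

/-- The factors of degrees `dᵢ` of a monomial of degree `∑ dᵢ`. -/
def factors {α : Type} {s : ℕ} (d : Fin s → ℕ) (x : FreeMonoid α) : Fin s → FreeMonoid α :=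
  if h : ∃ V : Fin s → FreeMonoid α, (∀ i, len (V i) = d i) ∧ (List.ofFn V).prod = x
  then h.choose else 1

theorem factors_prod {α : Type} {s : ℕ} {d : Fin s → ℕ} {V : Fin s → FreeMonoid α}
    (hV : ∀ i, len (V i) = d i) : factors d (List.ofFn V).prod = V := by
  have h : ∃ W : Fin s → FreeMonoid α,
      (∀ i, len (W i) = d i) ∧ (List.ofFn W).prod = (List.ofFn V).prod := ⟨V, hV, rfl⟩
  rw [factors, dif_pos h]
  exact ofFn_prod_inj (fun i => (h.choose_spec.1 i).trans (hV i).symm) h.choose_spec.2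

/-- Interleaving: `weave d U (∏ vᵢ) = ∏ uᵢ vᵢ` when `vᵢ` has degree `dᵢ`. -/
def weave {α : Type} {s : ℕ} (d : Fin s → ℕ) (U : Fin s → FreeMonoid α) (x : FreeMonoid α) :
    FreeMonoid α :=
  (List.ofFn fun i => U i * factors d x i).prod

theorem weave_prod {α : Type} {s : ℕ} {d : Fin s → ℕ} (U : Fin s → FreeMonoid α)
    {V : Fin s → FreeMonoid α} (hV : ∀ i, len (V i) = d i) :
    weave d U (List.ofFn V).prod = (List.ofFn fun i => U i * V i).prod := by
  rw [weave, factors_prod hV]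

/-- Interleaving as a linear map. -/
def weaveL (K : Type) [Field K] {s : ℕ} (d : Fin s → ℕ) (U : Fin s → FreeMonoid (Fin 6)) :
    FreeA K →ₗ[K] FreeA K :=
  MonoidAlgebra.mapDomainLinearMap K K (weave d U)

theorem weaveL_single (K : Type) [Field K] {s : ℕ} (d : Fin s → ℕ)
    (U : Fin s → FreeMonoid (Fin 6)) (x : FreeMonoid (Fin 6)) :
    weaveL K d U (MonoidAlgebra.single x 1) = MonoidAlgebra.single (weave d U x) 1 := by
  simp [weaveL]

theorem single_ofFn_prod (K : Type) [Field K] {s : ℕ} (W : Fin s → FreeMonoid (Fin 6)) :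
    (MonoidAlgebra.single (List.ofFn W).prod 1 : FreeA K) =
      (List.ofFn fun i => (MonoidAlgebra.single (W i) 1 : FreeA K)).prod := by
  have := map_list_prod (MonoidAlgebra.of K (FreeMonoid (Fin 6))) (List.ofFn W)
  simpa [List.map_ofFn, Function.comp_def] using this

/-- Multilinear maps that agree on generating sets agree on the spans. -/
theorem multilinear_eq_of_span {R ι N : Type*} {M : ι → Type*} [Semiring R]
    [∀ i, AddCommMonoid (M i)] [∀ i, Module R (M i)] [AddCommMonoid N] [Module R N] [Fintype ι]
    (f g : MultilinearMap R M N) (S : ∀ i, Set (M i))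
    (h : ∀ a, (∀ i, a i ∈ S i) → f a = g a)
    (a : ∀ i, M i) (ha : ∀ i, a i ∈ Submodule.span R (S i)) : f a = g a := by
  suffices H : ∀ (T : Finset ι) (a : ∀ i, M i), (∀ i ∈ T, a i ∈ Submodule.span R (S i)) →
      (∀ i ∉ T, a i ∈ S i) → f a = g a from
    H Finset.univ a (fun i _ => ha i) fun i hi => absurd (Finset.mem_univ i) hi
  intro T
  induction T using Finset.induction_on with
  | empty => exact fun a _ h2 => h a fun i => h2 i (Finset.notMem_empty i)
  | insert j T hj ih =>
    intro a h1 h2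
    suffices H : ∀ b ∈ Submodule.span R (S j),
        f (Function.update a j b) = g (Function.update a j b) by
      simpa using H (a j) (h1 j (Finset.mem_insert_self j T))
    intro b hb
    induction hb using Submodule.span_induction with
    | mem b hb =>
      refine ih _ (fun i hi => ?_) (fun i hi => ?_)
      · rw [Function.update_of_ne (ne_of_mem_of_not_mem hi hj)]
        exact h1 i (Finset.mem_insert_of_mem hi)
      · by_cases hij : i = j
        · subst hij
          simpa using hb
        · rw [Function.update_of_ne hij]
          exact h2 i (by simp [hij, hi])
    | zero => rw [f.map_update_zero, g.map_update_zero]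
    | add b c _ _ hb hc => rw [f.map_update_add, g.map_update_add, hb, hc]
    | smul r b _ hb => rw [f.map_update_smul, g.map_update_smul, hb]

/-- Interleaving of a product of homogeneous elements. -/
theorem weaveL_prod (K : Type) [Field K] {s : ℕ} (d : Fin s → ℕ)
    (U : Fin s → FreeMonoid (Fin 6)) (a : Fin s → FreeA K) (ha : ∀ i, a i ∈ Hgr K (d i)) :
    weaveL K d U (List.ofFn a).prod =
      (List.ofFn fun i => MonoidAlgebra.single (U i) (1 : K) * a i).prod := by
  have := multilinear_eq_of_span
    ((weaveL K d U).compMultilinearMap (MultilinearMap.mkPiAlgebraFin K s (FreeA K)))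
    ((MultilinearMap.mkPiAlgebraFin K s (FreeA K)).compLinearMap
      fun i => LinearMap.mulLeft K (MonoidAlgebra.single (U i) (1 : K)))
    (fun i => {b | ∃ w : FreeMonoid (Fin 6), len w = d i ∧ b = MonoidAlgebra.single w (1 : K)})
    ?_ a ha
  · simpa using this
  · intro b hb
    choose V hV hb using hb
    obtain rfl : b = fun i => MonoidAlgebra.single (V i) 1 := funext hb
    simp only [LinearMap.compMultilinearMap_apply, MultilinearMap.mkPiAlgebraFin_apply,
      MultilinearMap.compLinearMap_apply, LinearMap.mulLeft_apply]
    rw [← single_ofFn_prod, weaveL_single, weave_prod U hV, single_ofFn_prod]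
    simp [MonoidAlgebra.single_mul_single]

theorem lex_append_cases {α : Type} {r : α → α → Prop} : ∀ {a b c d : List α},
    a.length = c.length → List.Lex r (a ++ b) (c ++ d) →
      List.Lex r a c ∨ a = c ∧ List.Lex r b d
  | [], _, [], _, _, h => Or.inr ⟨rfl, h⟩
  | x :: a, b, y :: c, d, hl, h => by
    rw [List.cons_append, List.cons_append] at h
    cases h with
    | rel h => exact Or.inl (List.Lex.rel h)
    | cons h =>
      rcases lex_append_cases (by simpa using hl) h with hac | ⟨rfl, hbd⟩
      · exact Or.inl (List.Lex.cons hac)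
      · exact Or.inr ⟨rfl, hbd⟩

theorem lex_append_of_lex {α : Type} {r : α → α → Prop} {a c : List α} (b d : List α)
    (hl : a.length = c.length) (h : List.Lex r a c) : List.Lex r (a ++ b) (c ++ d) := by
  induction h with
  | nil => simp at hl
  | rel h => exact List.Lex.rel h
  | cons _ ih => exact List.Lex.cons (ih (by simpa using hl))

/-- Inserting common factors preserves the lexicographic order. -/
theorem lex_interleave {α : Type} {r : α → α → Prop} :
    ∀ {s : ℕ} (A X Y : Fin s → FreeMonoid α), (∀ i, len (X i) = len (Y i)) →
      List.Lex r (FreeMonoid.toList (List.ofFn X).prod) (FreeMonoid.toList (List.ofFn Y).prod) →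
      List.Lex r (FreeMonoid.toList (List.ofFn fun i => A i * X i).prod)
        (FreeMonoid.toList (List.ofFn fun i => A i * Y i).prod)
  | 0, A, X, Y, _, h => by simp at h
  | s + 1, A, X, Y, hl, h => by
    simp only [List.ofFn_succ, List.prod_cons, FreeMonoid.toList_mul, List.append_assoc] at h ⊢
    refine List.Lex.append_left r ?_ _
    rcases lex_append_cases (hl 0) h with h | ⟨h0, h⟩
    · exact lex_append_of_lex _ _ (hl 0) h
    · rw [h0]
      exact List.Lex.append_left r
        (lex_interleave (fun i => A i.succ) _ _ (fun i => hl i.succ) h) _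

theorem bm_ofFn_prod {s : ℕ} (W : Fin s → FreeMonoid (Fin 6)) :
    bm (List.ofFn W).prod = (List.ofFn fun i => bm (W i)).prod := by
  rw [map_list_prod, List.map_ofFn]
  rfl

theorem mem_wordsOf {n : ℕ} {x : FreeMonoid (Fin 6)} : x ∈ wordsOf n ↔ len x = n := by
  simp only [wordsOf, Finset.mem_image, Finset.mem_univ, true_and]
  constructor
  · rintro ⟨f, rfl⟩
    simp [len]
  · rintro rfl
    exact ⟨(FreeMonoid.toList x).get,
      (congrArg FreeMonoid.ofList (List.ofFn_get _)).trans (FreeMonoid.ofList_toList x)⟩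

/-- Interleaving with monomials `U'ᵢ` such that `β U'ᵢ = β Uᵢ` maps `S(∏ Vᵢ)` to `S(∏ Uᵢ Vᵢ)`. -/
theorem weaveL_mem_SP (K : Type) [Field K] {s : ℕ} {d : Fin s → ℕ}
    {U U' V : Fin s → FreeMonoid (Fin 6)} (hV : ∀ i, len (V i) = d i)
    (hU' : ∀ i, bm (U' i) = bm (U i)) {x : FreeA K} (hx : x ∈ SP K (bm (List.ofFn V).prod)) :
    weaveL K d U' x ∈ SP K (bm (List.ofFn fun i => U i * V i).prod) := by
  have hlU : ∀ i, len (U' i) = len (U i) := fun i => by rw [← len_bm, hU', len_bm]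
  have hle : SP K (bm (List.ofFn V).prod) ≤
      (SP K (bm (List.ofFn fun i => U i * V i).prod)).comap (weaveL K d U') := by
    refine Submodule.span_le.mpr ?_
    rintro _ ⟨y, hy, hlt, rfl⟩
    rw [len_bm, len_ofFn_prod] at hy
    simp only [hV] at hy
    obtain ⟨Y, hY, rfl⟩ := exists_ofFn_prod d y hy
    rw [SetLike.mem_coe, Submodule.mem_comap, weaveL_single, weave_prod U' hY]
    have hlen : len (List.ofFn fun i => U' i * Y i).prod =
        len (List.ofFn fun i => U i * V i).prod := by
      simp [len_ofFn_prod, len_mul, hlU, hY, hV]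
    refine Submodule.subset_span ⟨_, by rw [hlen, len_bm], ⟨by rw [len_bm, len_bm, hlen], ?_⟩, rfl⟩
    have h := hlt.2
    rw [bm_ofFn_prod, bm_ofFn_prod] at h
    simp only [bm_ofFn_prod, map_mul, hU']
    exact lex_interleave _ _ _ (fun i => by rw [len_bm, len_bm, hY, hV]) h
  exact hle hx

/-- Decomposition of the component `w(n)`, where `w = ∏ Uᵢ Vᵢ`, according to the monomials
replacing the `Uᵢ`. -/
theorem wComp_interleave (K : Type) [Field K] {s : ℕ} {e d : Fin s → ℕ}
    {U V : Fin s → FreeMonoid (Fin 6)} (hU : ∀ i, len (U i) = e i) (hV : ∀ i, len (V i) = d i)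
    (n : Fin 6 → ℤ) :
    wComp K (bm (List.ofFn fun i => U i * V i).prod) n =
      ∑ U' ∈ Fintype.piFinset fun i => (wordsOf (e i)).filter fun a => bm a = bm (U i),
        weaveL K d U' (wComp K (bm (List.ofFn V).prod) fun c =>
          n c - ((FreeMonoid.toList (List.ofFn U').prod).count c : ℤ)) := by
  have hlV : len (bm (List.ofFn V).prod) = ∑ i, d i := by
    simp [len_bm, len_ofFn_prod, hV]
  have hlW : len (bm (List.ofFn fun i => U i * V i).prod) = ∑ i, (e i + d i) := by
    simp [len_bm, len_ofFn_prod, len_mul, hU, hV]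
  simp only [wComp, map_sum, weaveL_single, hlV, hlW]
  rw [Finset.sum_sigma']
  symm
  refine Finset.sum_bij (fun p _ => weave d p.1 p.2) ?_ ?_ ?_ (fun _ _ => rfl)
  · rintro ⟨A, x⟩ hp
    simp only [Finset.mem_sigma, Fintype.mem_piFinset, Finset.mem_filter, mem_wordsOf] at hp ⊢
    obtain ⟨hA, hx, hbx, hc⟩ := hp
    obtain ⟨X, hX, rfl⟩ := exists_ofFn_prod d x hx
    rw [bm_ofFn_prod, bm_ofFn_prod] at hbx
    have hbX : ∀ i, bm (X i) = bm (V i) :=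
      congrFun (ofFn_prod_inj (fun i => by rw [len_bm, len_bm, hX, hV]) hbx)
    rw [weave_prod A hX]
    refine ⟨by simp [len_ofFn_prod, len_mul, hA, hX], ?_, fun c => ?_⟩
    · simp [bm_ofFn_prod, hA, hbX]
    · have := hc c
      rw [count_ofFn_prod, count_ofFn_prod] at this
      simp only [count_ofFn_prod, FreeMonoid.toList_mul, List.count_append,
        Finset.sum_add_distrib]
      push_cast at this ⊢
      linarith
  · rintro ⟨A, x⟩ hp ⟨B, y⟩ hq h
    simp only [Finset.mem_sigma, Fintype.mem_piFinset, Finset.mem_filter, mem_wordsOf] at hp hq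
    obtain ⟨hA, hx, -⟩ := hp
    obtain ⟨hB, hy, -⟩ := hq
    obtain ⟨X, hX, rfl⟩ := exists_ofFn_prod d x hx
    obtain ⟨Y, hY, rfl⟩ := exists_ofFn_prod d y hy
    simp only [weave_prod A hX, weave_prod B hY] at h
    have h' := congrFun (ofFn_prod_inj
      (fun i => by rw [len_mul, len_mul, (hA i).1, (hB i).1, hX, hY]) h)
    have h'' := fun i => mul_inj_of_len ((hA i).1.trans (hB i).1.symm) (h' i)
    obtain rfl : A = B := funext fun i => (h'' i).1
    obtain rfl : X = Y := funext fun i => (h'' i).2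
    rfl
  · intro x hx
    simp only [Finset.mem_filter, mem_wordsOf] at hx
    obtain ⟨hx, hbx, hc⟩ := hx
    obtain ⟨W, hW, rfl⟩ := exists_ofFn_prod _ x hx
    choose A X hA hX hAX using fun i => exists_mul_of_len (hW i)
    obtain rfl : (fun i => A i * X i) = W := funext hAX
    rw [bm_ofFn_prod, bm_ofFn_prod] at hbx
    have hb := congrFun (ofFn_prod_inj
      (fun i => by rw [len_bm, len_bm, len_mul, len_mul, hA, hX, hU, hV]) hbx)
    simp only [map_mul] at hb
    have hb' := fun i => mul_inj_of_len (by rw [len_bm, len_bm, hA, hU]) (hb i)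
    refine ⟨⟨A, (List.ofFn X).prod⟩, ?_, weave_prod A hX⟩
    simp only [Finset.mem_sigma, Fintype.mem_piFinset, Finset.mem_filter, mem_wordsOf]
    refine ⟨fun i => ⟨hA i, (hb' i).1⟩, by simp [len_ofFn_prod, hX], ?_, fun c => ?_⟩
    · simp [bm_ofFn_prod, fun i => (hb' i).2]
    · have := hc c
      simp only [count_ofFn_prod, FreeMonoid.toList_mul, List.count_append,
        Finset.sum_add_distrib] at this ⊢
      push_cast at this ⊢
      linarith

theorem sum_count_eq_len (x : FreeMonoid (Fin 6)) :
    ∑ c, (FreeMonoid.toList x).count c = len x := by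
  simpa [len] using Multiset.sum_count_eq_card (s := Finset.univ)
    (m := (FreeMonoid.toList x : Multiset (Fin 6))) (fun _ _ => Finset.mem_univ _)

theorem SP_le_Hgr (K : Type) [Field K] (z : FreeMonoid (Fin 2)) :
    SP K z ≤ Hgr K (len z) :=
  Submodule.span_mono fun _ ⟨w, hw, _, h⟩ => ⟨w, hw, h⟩

theorem wComp_mem_Hgr (K : Type) [Field K] (z : FreeMonoid (Fin 2)) (n : Fin 6 → ℤ) :
    wComp K z n ∈ Hgr K (len z) :=
  Submodule.sum_mem _ fun x hx => Submodule.subset_span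
    ⟨x, mem_wordsOf.mp (Finset.mem_filter.mp hx).1, rfl⟩

end

theorem stmt12 (K : Type) [Field K] (m : ℕ → ℕ)
    (hmono : StrictMono m) (hm1 : 10 ^ 8 < m 0)
    (hdvd : ∀ i, 40 * m i ∣ m (i + 1)) (hgrow : ∀ i, 2 ^ (i + 102) * m i < m (i + 1))
    (F : ℕ → Finset (FreeA K)) (hF : ∀ i, (F i : Set (FreeA K)) ⊆ (Hgr K (m i) : Set (FreeA K)))
    (R c : ℕ → (FreeA K →ₗ[K] FreeA K))
    (hR0 : ∀ a ∈ Hgr K (m 0), R 0 a = a)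
    (hRH : ∀ i, ∀ a ∈ Hgr K (m i), R i a ∈ Hgr K (m i))
    (hcH : ∀ i, ∀ a ∈ Hgr K (m i), c i a ∈ Hgr K (m i))
    (hcker : ∀ i, ∀ a ∈ Hgr K (m i),
      (c i a = 0 ↔ a ∈ Submodule.span K (⇑(R i) '' (F i : Set (FreeA K)))))
    (hrec : ∀ (i : ℕ) (l : List (FreeMonoid (Fin 6))),
      l.length = m (i + 1) / m i → (∀ w ∈ l, len w = m i) →
      R (i + 1) (MonoidAlgebra.single l.prod 1) =
        c i (R i (MonoidAlgebra.single l.headI 1)) *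
          (l.tail.map fun w => R i (MonoidAlgebra.single w 1)).prod)
    -- the fixed block decomposition of the degree `m k`
    (k s : ℕ) (e d : Fin s → ℕ)
    (hed : 50 * (∑ i, d i) < (∑ i, e i)) (hsum : (∑ i, (e i + d i)) = m k)
    (g : Fin s → (FreeA K →ₗ[K] FreeA K))
    (hgH : ∀ i, ∀ a ∈ Hgr K (d i), g i a ∈ Hgr K (d i))
    (hfact : ∀ U V : Fin s → FreeMonoid (Fin 6),
      (∀ i, len (U i) = e i) → (∀ i, len (V i) = d i) →
      R k (MonoidAlgebra.single (List.ofFn fun i => U i * V i).prod 1) =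
        (List.ofFn fun i =>
          MonoidAlgebra.single (U i) (1 : K) * g i (MonoidAlgebra.single (V i) 1)).prod)
    -- the permutation `σ`, the linear maps induced by `σ` and `σ⁻¹`, and `f_k`
    (σ : Equiv.Perm (Fin (m k))) (Pσ Pτ fk : FreeA K →ₗ[K] FreeA K)
    (hPσ : ∀ fn : Fin (m k) → Fin 6,
      Pσ (MonoidAlgebra.single (wordOfFn fn) 1) = MonoidAlgebra.single (wordOfFn (fn ∘ σ)) 1)
    (hPτ : ∀ fn : Fin (m k) → Fin 6,
      Pτ (MonoidAlgebra.single (wordOfFn fn) 1) = MonoidAlgebra.single (wordOfFn (fn ∘ σ.symm)) 1)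
    (hσ : ∀ U V : Fin s → FreeMonoid (Fin 6),
      (∀ i, len (U i) = e i) → (∀ i, len (V i) = d i) →
      Pσ (MonoidAlgebra.single (List.ofFn fun i => U i * V i).prod 1) =
        MonoidAlgebra.single ((List.ofFn U).prod * (List.ofFn V).prod) 1)
    (hfk : ∀ V : Fin s → FreeMonoid (Fin 6), (∀ i, len (V i) = d i) →
      fk (MonoidAlgebra.single (List.ofFn V).prod 1) =
        (List.ofFn fun i => g i (MonoidAlgebra.single (V i) 1)).prod)
    -- the data of the statement
    (U V : Fin s → FreeMonoid (Fin 6))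
    (hU : ∀ i, len (U i) = e i) (hV : ∀ i, len (V i) = d i)
    (w u v : FreeMonoid (Fin 6))
    (hw : w = (List.ofFn fun i => U i * V i).prod)
    (hu : u = (List.ofFn U).prod) (hv : v = (List.ofFn V).prod)
    (hfv : ∀ n : Fin 6 → ℤ, (∑ i, n i) = (len v : ℤ) →
      fk (wComp K (bm v) n) ∈ Submodule.map fk (SP K (bm v))) :
    ∀ n : Fin 6 → ℤ, (∑ i, n i) = (m k : ℤ) →
      R k (wComp K (bm w) n) ∈ Submodule.map (R k) (SP K (bm w)) := by
  intro n hn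
  have hlv : len v = ∑ i, d i := by simp [hv, len_ofFn_prod, hV]
  have hcomm : ∀ A : Fin s → FreeMonoid (Fin 6), (∀ i, len (A i) = e i) →
      ∀ x ∈ Hgr K (∑ i, d i), R k (weaveL K d A x) = weaveL K d A (fk x) := by
    intro A hA x hx
    induction hx using Submodule.span_induction with
    | mem x hx =>
      obtain ⟨y, hy, rfl⟩ := hx
      obtain ⟨Y, hY, rfl⟩ := exists_ofFn_prod d y hy
      rw [weaveL_single, weave_prod A hY, hfact A Y hA hY, hfk Y hY,
        weaveL_prod K d A _ fun i => hgH i _ (Submodule.subset_span ⟨Y i, hY i, rfl⟩)]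
    | zero => simp
    | add x y _ _ hx hy => simp only [map_add, hx, hy]
    | smul r x _ hx => simp only [map_smul, hx]
  subst hw hv
  rw [wComp_interleave K hU hV, map_sum]
  refine Submodule.sum_mem _ fun A hA => ?_
  simp only [Fintype.mem_piFinset, Finset.mem_filter, mem_wordsOf] at hA
  have hlA : len (List.ofFn A).prod = ∑ i, e i := by simp [len_ofFn_prod, hA]
  obtain ⟨x, hx, hfx⟩ := hfv
    (fun c => n c - ((FreeMonoid.toList (List.ofFn A).prod).count c : ℤ)) (by
      rw [Finset.sum_sub_distrib, hn, ← hsum, ← Nat.cast_sum, sum_count_eq_len, hlA, hlv,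
        Finset.sum_add_distrib]
      push_cast
      ring)
  have hH := wComp_mem_Hgr K (bm (List.ofFn V).prod)
    (fun c => n c - ((FreeMonoid.toList (List.ofFn A).prod).count c : ℤ))
  have hxH := SP_le_Hgr K _ hx
  rw [len_bm, hlv] at hH hxH
  rw [hcomm A (fun i => (hA i).1) _ hH, ← hfx, ← hcomm A (fun i => (hA i).1) x hxH]
  exact Submodule.mem_map_of_mem (weaveL_mem_SP K hV (fun i => (hA i).2) hx)
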